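/- arXiv:2303.02645 — 3 statements merged into one kernel-verified Lean document; each statement's English description precedes it below -/
import Mathlib

section
/- (Theorem 1.) Fix a family of nested opportunity sets (Λ, p̃) for income y, an alternative k ∈ C, a price p_k ∈ ℝ, and let W ω denote the NOS welfare measure of type ω at alternative k with price p_k. Then for every w ∈ Λ, every price vector p' : C → ℝ and every j ∈ C: μ {ω | w ≤ W ω and j is weakly optimal for ω at (p', y)} equals P_{j,k}(p', q, y) if p_k ≤ p̃ k w, and equals 0 otherwise, where q : C → ℝ is the price vector with q k = p_k and q c = p̃ c w for c ≠ k. -/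
open MeasureTheory
open scoped ENNReal BigOperators

/-- `i` is weakly optimal for type `ω` at price vector `p` and income `y`:
its utility is weakly largest among all alternatives. -/
def WeakOpt {Ω : Type*} {n : ℕ} (U : Ω → Fin n → ℝ → ℝ) (ω : Ω)
    (p : Fin n → ℝ) (y : ℝ) (i : Fin n) : Prop :=
  ∀ c, U ω c (y - p c) ≤ U ω i (y - p i)

/-- Choice probability `P_i(p, y)`. -/
noncomputable def ChoiceProb {Ω : Type*} [MeasurableSpace Ω] {n : ℕ}
    (μ : Measure Ω) (U : Ω → Fin n → ℝ → ℝ) (p : Fin n → ℝ) (y : ℝ) (i : Fin n) : ℝ≥0∞ :=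
  μ {ω | WeakOpt U ω p y i}

/-- Transition probability `P_{i,j}(p, p', y)`. -/
noncomputable def TransProb {Ω : Type*} [MeasurableSpace Ω] {n : ℕ}
    (μ : Measure Ω) (U : Ω → Fin n → ℝ → ℝ) (p p' : Fin n → ℝ) (y : ℝ) (i j : Fin n) : ℝ≥0∞ :=
  μ {ω | WeakOpt U ω p y i ∧ WeakOpt U ω p' y j}

/-- Regularity condition (R1): for every type, every pair of alternatives and every
residual numeraire level, sufficiently poor levels at `c'` are worse and sufficiently
rich levels at `c'` are better. -/
def Reg1 {Ω : Type*} {n : ℕ} (U : Ω → Fin n → ℝ → ℝ) : Prop :=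
  ∀ (ω : Ω) (c c' : Fin n) (m : ℝ),
    (∃ m₀ : ℝ, ∀ m' ≤ m₀, U ω c' m' < U ω c m) ∧
    (∃ m₁ : ℝ, ∀ m', m₁ ≤ m' → U ω c m < U ω c' m')

/-- Negligible ties (R2): at any price vector and income, the set of types indifferent
between two distinct alternatives has measure zero. -/
def Reg2 {Ω : Type*} [MeasurableSpace Ω] {n : ℕ} (μ : Measure Ω)
    (U : Ω → Fin n → ℝ → ℝ) : Prop :=
  ∀ (q : Fin n → ℝ) (y : ℝ) (c c' : Fin n), c ≠ c' →
    μ {ω | U ω c (y - q c) = U ω c' (y - q c')} = 0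

/-- A family of nested opportunity sets, described by an index set `Λ ⊆ ℝ`
and virtual prices `ptilde`. -/
structure NOSFamily {n : ℕ} (Λ : Set ℝ) (ptilde : ℝ → Fin n → ℝ) : Prop where
  nonempty : Λ.Nonempty
  closed : IsClosed Λ
  cont : ∀ c : Fin n, ContinuousOn (fun l => ptilde l c) Λ
  anti : ∀ l ∈ Λ, ∀ l' ∈ Λ, l < l' →
    (∀ c, ptilde l' c ≤ ptilde l c) ∧ ∃ c, ptilde l' c < ptilde l c
  unbddAbove : ∀ (c : Fin n) (M : ℝ), ∃ l ∈ Λ, M ≤ ptilde l c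
  unbddBelow : ∃ c : Fin n, ∀ M : ℝ, ∃ l ∈ Λ, ptilde l c ≤ M

/-- The NOS welfare measure of type `ω` at alternative `k` with price `pk`. -/
noncomputable def NOSWelfare {Ω : Type*} {n : ℕ} (U : Ω → Fin n → ℝ → ℝ)
    (Λ : Set ℝ) (ptilde : ℝ → Fin n → ℝ) (y : ℝ) (k : Fin n) (pk : ℝ) (ω : Ω) : ℝ :=
  sSup {l | l ∈ Λ ∧ ∀ c, U ω c (y - ptilde l c) ≤ U ω k (y - pk)}

/-- The money-metric utility of type `ω` at alternative `k` with price `pk`,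
income `y` and reference prices `r`. -/
noncomputable def MMU {Ω : Type*} {n : ℕ} (U : Ω → Fin n → ℝ → ℝ)
    (r : Fin n → ℝ) (y : ℝ) (k : Fin n) (pk : ℝ) (ω : Ω) : ℝ :=
  sSup {l : ℝ | ∀ c, U ω c (l - r c) ≤ U ω k (y - pk)}

/-- `CV` is a compensating variation for the price change from `p` to `p'` at income `y`. -/
def IsCV {Ω : Type*} {n : ℕ} (U : Ω → Fin n → ℝ → ℝ)
    (p p' : Fin n → ℝ) (y : ℝ) (CV : Ω → ℝ) : Prop :=
  ∀ ω, (⨆ c, U ω c (y - p c)) = ⨆ c, U ω c (y - p' c - CV ω)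

/-- `EV` is an equivalent variation for the price change from `p` to `p'` at income `y`. -/
def IsEV {Ω : Type*} {n : ℕ} (U : Ω → Fin n → ℝ → ℝ)
    (p p' : Fin n → ℝ) (y : ℝ) (EV : Ω → ℝ) : Prop :=
  ∀ ω, (⨆ c, U ω c (y - p c - EV ω)) = ⨆ c, U ω c (y - p' c)

/-- A family of nested opportunity sets has antitone virtual prices. -/
theorem NOSFamily.antitoneOn {n : ℕ} {Λ : Set ℝ} {ptilde : ℝ → Fin n → ℝ}
    (hFam : NOSFamily Λ ptilde) (c : Fin n) : AntitoneOn (fun l => ptilde l c) Λ := by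
  intro l hl l' hl' h
  rcases h.eq_or_lt with rfl | h
  · exact le_rfl
  · exact (hFam.anti l hl l' hl' h).1 c

section WelfareSet

variable {n : ℕ} {u : Fin n → ℝ → ℝ} {Λ : Set ℝ} {ptilde : ℝ → Fin n → ℝ} {y v : ℝ}

theorem NOSFamily.welfareSet_mem_of_le (hFam : NOSFamily Λ ptilde) (hMono : ∀ c, StrictMono (u c))
    {l l' : ℝ} (hl : l ∈ Λ) (hll' : l ≤ l')
    (hl' : l' ∈ {l | l ∈ Λ ∧ ∀ c, u c (y - ptilde l c) ≤ v}) :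
    l ∈ {l | l ∈ Λ ∧ ∀ c, u c (y - ptilde l c) ≤ v} :=
  ⟨hl, fun c => ((hMono c).monotone
    (sub_le_sub_left (hFam.antitoneOn c hl hl'.1 hll') y)).trans (hl'.2 c)⟩

theorem NOSFamily.isClosed_welfareSet (hFam : NOSFamily Λ ptilde) (hCont : ∀ c, Continuous (u c)) :
    IsClosed {l | l ∈ Λ ∧ ∀ c, u c (y - ptilde l c) ≤ v} := by
  have h : {l | l ∈ Λ ∧ ∀ c, u c (y - ptilde l c) ≤ v} =
      Λ ∩ ⋂ c, Λ ∩ (fun l => u c (y - ptilde l c)) ⁻¹' Set.Iic v := by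
    ext l
    simp only [Set.mem_ofPred_eq, Set.mem_inter_iff, Set.mem_iInter, Set.mem_preimage, Set.mem_Iic]
    exact ⟨fun h => ⟨h.1, fun c => ⟨h.1, h.2 c⟩⟩, fun h => ⟨h.1, fun c => (h.2 c).2⟩⟩
  rw [h]
  exact hFam.closed.inter (isClosed_iInter fun c =>
    ((hCont c).comp_continuousOn (continuousOn_const.sub (hFam.cont c))).preimage_isClosed_of_isClosed
      hFam.closed isClosed_Iic)

theorem NOSFamily.welfareSet_nonempty [NeZero n] (hFam : NOSFamily Λ ptilde)
    (hMono : ∀ c, StrictMono (u c)) (hlow : ∀ c, ∃ m₀, u c m₀ ≤ v) :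
    {l | l ∈ Λ ∧ ∀ c, u c (y - ptilde l c) ≤ v}.Nonempty := by
  choose m₀ hm₀ using hlow
  choose l hlΛ hl using fun c => hFam.unbddAbove c (y - m₀ c)
  obtain ⟨d, hd⟩ := Finite.exists_min l
  refine ⟨l d, hlΛ d, fun c => le_trans ((hMono c).monotone ?_) (hm₀ c)⟩
  have := hFam.antitoneOn c (hlΛ d) (hlΛ c) (hd c)
  simp only at this
  linarith [hl c]

theorem NOSFamily.bddAbove_welfareSet (hFam : NOSFamily Λ ptilde)
    (hMono : ∀ c, StrictMono (u c)) (hhigh : ∀ c, ∃ m₁, v < u c m₁) :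
    BddAbove {l | l ∈ Λ ∧ ∀ c, u c (y - ptilde l c) ≤ v} := by
  obtain ⟨c, hc⟩ := hFam.unbddBelow
  obtain ⟨m₁, hm₁⟩ := hhigh c
  obtain ⟨b, hbΛ, hb⟩ := hc (y - m₁)
  refine ⟨b, fun l hl => le_of_not_gt fun hbl => ?_⟩
  have hmem := (hFam.welfareSet_mem_of_le hMono hbΛ hbl.le hl).2 c
  exact hm₁.not_ge (((hMono c).monotone (by linarith)).trans hmem)

end WelfareSet

/-- The supremum defining the welfare measure is attained, so its upper level sets are described by
the inequalities that define the set under the supremum. -/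
theorem le_NOSWelfare_iff {Ω : Type*} {n : ℕ} {U : Ω → Fin n → ℝ → ℝ} {ω : Ω}
    (hCont : ∀ c, Continuous (U ω c)) (hMono : ∀ c, StrictMono (U ω c)) (hR1 : Reg1 U)
    {Λ : Set ℝ} {ptilde : ℝ → Fin n → ℝ} (hFam : NOSFamily Λ ptilde)
    (y : ℝ) (k : Fin n) (pk : ℝ) {w : ℝ} (hw : w ∈ Λ) :
    w ≤ NOSWelfare U Λ ptilde y k pk ω ↔
      ∀ c, U ω c (y - ptilde w c) ≤ U ω k (y - pk) := by
  have : NeZero n := ⟨k.pos.ne'⟩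
  have hbdd := hFam.bddAbove_welfareSet (y := y) (v := U ω k (y - pk)) hMono
    fun c => (hR1 ω k c (y - pk)).2.imp fun m h => h m le_rfl
  refine ⟨fun h => ?_, fun h => le_csSup hbdd ⟨hw, h⟩⟩
  have hne := hFam.welfareSet_nonempty (y := y) (v := U ω k (y - pk)) hMono
    fun c => (hR1 ω k c (y - pk)).1.imp fun m h => (h m le_rfl).le
  exact (hFam.welfareSet_mem_of_le hMono hw h
    ((hFam.isClosed_welfareSet hCont).csSup_mem hne hbdd)).2

/-- Alternative `k` at price `pk` is weakly better than every alternative at prices `p` exactly when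
`pk ≤ p k` and `k` is weakly optimal once its own price in `p` is replaced by `pk`. -/
theorem forall_le_iff_weakOpt_update {Ω : Type*} {n : ℕ} {U : Ω → Fin n → ℝ → ℝ} {ω : Ω}
    (hMono : ∀ c, StrictMono (U ω c)) (p : Fin n → ℝ) (y : ℝ) (k : Fin n) (pk : ℝ) :
    (∀ c, U ω c (y - p c) ≤ U ω k (y - pk)) ↔
      pk ≤ p k ∧ WeakOpt U ω (Function.update p k pk) y k := by
  have hk : U ω k (y - p k) ≤ U ω k (y - pk) ↔ pk ≤ p k := by
    rw [(hMono k).le_iff_le, sub_le_sub_iff_left]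
  simp only [WeakOpt, Function.update_self]
  refine ⟨fun h => ⟨hk.1 (h k), fun c => ?_⟩, fun ⟨h, hopt⟩ c => ?_⟩
  · rcases eq_or_ne c k with rfl | hc
    · simp
    · simpa [hc] using h c
  · rcases eq_or_ne c k with rfl | hc
    · exact hk.2 h
    · simpa [hc] using hopt c

/-- Theorem 1: the joint distribution of the NOS welfare measure at `k`
and choosing `j` at prices `p'` is a transition probability at virtual prices. -/
theorem nos_welfare_joint_distribution {Ω : Type*} [MeasurableSpace Ω] {n : ℕ} (hn : 0 < n)
    (μ : Measure Ω) [IsProbabilityMeasure μ]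
    (U : Ω → Fin n → ℝ → ℝ)
    (hCont : ∀ ω c, Continuous (U ω c))
    (hMono : ∀ ω c, StrictMono (U ω c))
    (hR1 : Reg1 U)
    (Λ : Set ℝ) (ptilde : ℝ → Fin n → ℝ) (hFam : NOSFamily Λ ptilde)
    (y : ℝ) (k : Fin n) (pk : ℝ) (w : ℝ) (hw : w ∈ Λ)
    (p' : Fin n → ℝ) (j : Fin n) :
    μ {ω | w ≤ NOSWelfare U Λ ptilde y k pk ω ∧ WeakOpt U ω p' y j} =
      if pk ≤ ptilde w k
      then TransProb μ U p' (Function.update (ptilde w) k pk) y j k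
      else 0 := by
  have hset : {ω | w ≤ NOSWelfare U Λ ptilde y k pk ω ∧ WeakOpt U ω p' y j} =
      {ω | pk ≤ ptilde w k ∧ WeakOpt U ω p' y j ∧
        WeakOpt U ω (Function.update (ptilde w) k pk) y k} := by
    ext ω
    simp only [Set.mem_ofPred_eq]
    rw [le_NOSWelfare_iff (hCont ω) (hMono ω) hR1 hFam y k pk hw,
      forall_le_iff_weakOpt_update (hMono ω)]
    tauto
  rw [hset]
  split_ifs with h <;> simp [h, TransProb]
end

section
/- (Corollary 3, distribution of the compensating variation given the initial choice.) Let p, p' : C → ℝ be price vectors, y ∈ ℝ an income, and CV : Ω → ℝ a compensating variation. Then for every i ∈ C and z ∈ ℝ: μ {ω | CV ω ≤ z and i is weakly optimal for ω at (p, y)} equals P_i(min(p, p' + z), y) if p i ≤ p' i + z, and equals 0 otherwise, where min denotes the componentwise minimum and p' + z the vector with components p' c + z. -/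
open MeasureTheory
open scoped ENNReal BigOperators

/-- For a type that weakly prefers `i` at `(p, y)`, the compensating variation is at most `z`
iff no alternative at prices `p' + z` beats `i` at price `p i`. -/
theorem IsCV.le_iff_of_weakOpt {Ω : Type*} {n : ℕ} {U : Ω → Fin n → ℝ → ℝ}
    (hMono : ∀ ω c, StrictMono (U ω c)) {p p' : Fin n → ℝ} {y : ℝ} {CV : Ω → ℝ}
    (hCV : IsCV U p p' y CV) {ω : Ω} {i : Fin n} (hi : WeakOpt U ω p y i) (z : ℝ) :
    CV ω ≤ z ↔ ∀ c, U ω c (y - (p' c + z)) ≤ U ω i (y - p i) := by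
  have : Nonempty (Fin n) := ⟨i⟩
  have hsup : ⨆ c, U ω c (y - p' c - CV ω) = U ω i (y - p i) :=
    (hCV ω).symm.trans
      (le_antisymm (ciSup_le hi)
        (le_ciSup (f := fun c => U ω c (y - p c)) (Set.finite_range _).bddAbove i))
  constructor
  · intro hz c
    calc U ω c (y - (p' c + z)) ≤ U ω c (y - p' c - CV ω) :=
          (hMono ω c).monotone (by linarith)
      _ ≤ ⨆ c, U ω c (y - p' c - CV ω) :=
          le_ciSup (f := fun c => U ω c (y - p' c - CV ω)) (Set.finite_range _).bddAbove c
      _ = U ω i (y - p i) := hsup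
  · intro h
    by_contra! hz
    obtain ⟨c, hc⟩ := exists_eq_ciSup_of_finite (f := fun c => U ω c (y - p' c - CV ω))
    have hlt : U ω c (y - p' c - CV ω) < U ω c (y - (p' c + z)) :=
      hMono ω c (by linarith)
    exact absurd (h c) (not_le.mpr (hsup ▸ hc ▸ hlt))

/-- Corollary 3, distribution of the CV given the initial choice. -/
theorem cv_given_initial_choice {Ω : Type*} [MeasurableSpace Ω] {n : ℕ} (hn : 0 < n)
    (μ : Measure Ω) [IsProbabilityMeasure μ]
    (U : Ω → Fin n → ℝ → ℝ)
    (hMono : ∀ ω c, StrictMono (U ω c))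
    (p p' : Fin n → ℝ) (y : ℝ) (CV : Ω → ℝ) (hCV : IsCV U p p' y CV)
    (i : Fin n) (z : ℝ) :
    μ {ω | CV ω ≤ z ∧ WeakOpt U ω p y i} =
      if p i ≤ p' i + z
      then ChoiceProb μ U (fun c => min (p c) (p' c + z)) y i
      else 0 := by
  split_ifs with hp
  · unfold ChoiceProb
    congr 1
    ext ω
    have hmin : WeakOpt U ω (fun c => min (p c) (p' c + z)) y i ↔
        WeakOpt U ω p y i ∧ ∀ c, U ω c (y - (p' c + z)) ≤ U ω i (y - p i) := by
      simp only [WeakOpt, min_eq_left hp, ← max_sub_sub_left, (hMono ω _).monotone.map_max,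
        max_le_iff, forall_and]
    rw [Set.mem_ofPred_eq, Set.mem_ofPred_eq, hmin, and_comm]
    exact and_congr_right fun hi => hCV.le_iff_of_weakOpt hMono hi z
  · convert measure_empty (μ := μ)
    refine Set.eq_empty_of_forall_notMem fun ω ⟨hz, hi⟩ => ?_
    have hlt : U ω i (y - p i) < U ω i (y - (p' i + z)) := hMono ω i (by linarith)
    exact hlt.not_ge ((hCV.le_iff_of_weakOpt hMono hi z).mp hz i)
end

section
/- (Theorem 4, joint distribution of the MMU and the compensating variation.) Let p, p' : C → ℝ be price vectors, y ∈ ℝ an income, and CV : Ω → ℝ a compensating variation. For i ∈ C let W_i ω be the money-metric utility of type ω at alternative i with price p i and reference prices p'. Then for all i, j ∈ C and w, z ∈ ℝ: μ {ω | w ≤ W_i ω and CV ω ≤ z and i is weakly optimal for ω at (p, y) and j is weakly optimal for ω at (p', y)} equals P_{i,j}(min(p, p' + min(z, y − w)), p', y) if p i ≤ p' i + min(z, y − w), and equals 0 otherwise, where min of price vectors is taken componentwise and p' + a is the vector with components p' c + a. -/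
open MeasureTheory
open scoped ENNReal BigOperators

/-- A level `w` is below the money-metric utility iff every alternative at reference prices
and income `w` is weakly worse than the given one. -/
theorem le_MMU_iff {Ω : Type*} {n : ℕ} {U : Ω → Fin n → ℝ → ℝ}
    (hCont : ∀ ω c, Continuous (U ω c)) (hMono : ∀ ω c, StrictMono (U ω c)) (hR1 : Reg1 U)
    (r : Fin n → ℝ) (y : ℝ) (k : Fin n) (pk : ℝ) (ω : Ω) (w : ℝ) :
    w ≤ MMU U r y k pk ω ↔ ∀ c, U ω c (w - r c) ≤ U ω k (y - pk) := by
  unfold MMU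
  set S := {l : ℝ | ∀ c, U ω c (l - r c) ≤ U ω k (y - pk)} with hS
  have hbdd : BddAbove S := by
    refine ⟨y - pk + r k, fun l hl => ?_⟩
    have := (hMono ω k).le_iff_le.1 (hl k)
    linarith
  have hne : S.Nonempty := by
    choose m hm using fun c => (hR1 ω k c (y - pk)).1
    obtain ⟨l, hl⟩ := (Set.finite_range fun c => m c + r c).bddBelow
    refine ⟨l, fun c => (hm c _ ?_).le⟩
    have : l ≤ m c + r c := hl ⟨c, rfl⟩
    linarith
  have hclosed : IsClosed S := by
    rw [hS, Set.ofPred_forall]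
    exact isClosed_iInter fun c => isClosed_le
      ((hCont ω c).comp (continuous_id.sub continuous_const)) continuous_const
  refine ⟨fun h c => ?_, fun h => le_csSup hbdd h⟩
  exact ((hMono ω c).monotone (sub_le_sub_right h _)).trans (hclosed.csSup_mem hne hbdd c)

/-- At an optimal alternative `i`, the compensating variation is at most `z` iff every
alternative at final prices and income `y - z` is weakly worse than `i`. -/
theorem IsCV.le_iff {Ω : Type*} {n : ℕ} {U : Ω → Fin n → ℝ → ℝ}
    (hMono : ∀ ω c, StrictMono (U ω c)) {p p' : Fin n → ℝ} {y : ℝ} {CV : Ω → ℝ}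
    (hCV : IsCV U p p' y CV) {ω : Ω} {i : Fin n} (hi : WeakOpt U ω p y i) (z : ℝ) :
    CV ω ≤ z ↔ ∀ c, U ω c (y - p' c - z) ≤ U ω i (y - p i) := by
  have : Nonempty (Fin n) := ⟨i⟩
  have hsup : (⨆ c, U ω c (y - p' c - CV ω)) = U ω i (y - p i) := by
    rw [← hCV ω]
    exact le_antisymm (ciSup_le hi)
      (le_ciSup (f := fun c => U ω c (y - p c)) (Set.finite_range _).bddAbove i)
  constructor
  · intro h c
    rw [← hsup]
    exact ((hMono ω c).monotone (sub_le_sub_left h _)).trans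
      (le_ciSup (f := fun c => U ω c (y - p' c - CV ω)) (Set.finite_range _).bddAbove c)
  · intro h
    obtain ⟨c, hc⟩ := exists_eq_ciSup_of_finite (f := fun c => U ω c (y - p' c - CV ω))
    have hle := h c
    rw [← hsup, ← hc] at hle
    have := (hMono ω c).le_iff_le.1 hle
    linarith

/-- The joint bound on the money-metric utility and the compensating variation at an optimal
alternative `i`, as a single bound at the smaller of the two compensations. -/
theorem IsCV.le_MMU_and_le_iff {Ω : Type*} {n : ℕ} {U : Ω → Fin n → ℝ → ℝ}
    (hCont : ∀ ω c, Continuous (U ω c)) (hMono : ∀ ω c, StrictMono (U ω c)) (hR1 : Reg1 U)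
    {p p' : Fin n → ℝ} {y : ℝ} {CV : Ω → ℝ} (hCV : IsCV U p p' y CV) {ω : Ω} {i : Fin n}
    (hi : WeakOpt U ω p y i) (w z : ℝ) :
    w ≤ MMU U p' y i (p i) ω ∧ CV ω ≤ z ↔
      ∀ c, U ω c (y - (p' c + min z (y - w))) ≤ U ω i (y - p i) := by
  rw [le_MMU_iff hCont hMono hR1, hCV.le_iff hMono hi, ← forall_and]
  refine forall_congr' fun c => ?_
  have hw : y - (p' c + (y - w)) = w - p' c := by ring
  have hz : y - (p' c + z) = y - p' c - z := by ring
  rw [← min_add_add_left, ← max_sub_sub_left, (hMono ω c).monotone.map_max, max_le_iff, hw, hz,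
    and_comm]

/-- Weak optimality of `i` at the componentwise minimum of two price vectors, when `i` is
no more expensive at the first. -/
theorem weakOpt_min_iff {Ω : Type*} {n : ℕ} {U : Ω → Fin n → ℝ → ℝ}
    (hMono : ∀ ω c, StrictMono (U ω c)) {p q : Fin n → ℝ} {y : ℝ} {ω : Ω} {i : Fin n}
    (h : p i ≤ q i) :
    WeakOpt U ω (fun c => min (p c) (q c)) y i ↔
      WeakOpt U ω p y i ∧ ∀ c, U ω c (y - q c) ≤ U ω i (y - p i) := by
  simp only [WeakOpt]
  rw [min_eq_left h, ← forall_and]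
  refine forall_congr' fun c => ?_
  rw [← max_sub_sub_left, (hMono ω c).monotone.map_max, max_le_iff]

/-- Theorem 4: joint distribution of the MMU (with final prices as
reference prices) and the compensating variation. -/
theorem mmu_cv_joint_distribution {Ω : Type*} [MeasurableSpace Ω] {n : ℕ} (hn : 0 < n)
    (μ : Measure Ω) [IsProbabilityMeasure μ]
    (U : Ω → Fin n → ℝ → ℝ)
    (hCont : ∀ ω c, Continuous (U ω c))
    (hMono : ∀ ω c, StrictMono (U ω c))
    (hR1 : Reg1 U)
    (p p' : Fin n → ℝ) (y : ℝ) (CV : Ω → ℝ) (hCV : IsCV U p p' y CV)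
    (i j : Fin n) (w z : ℝ) :
    μ {ω | w ≤ MMU U p' y i (p i) ω ∧ CV ω ≤ z ∧
           WeakOpt U ω p y i ∧ WeakOpt U ω p' y j} =
      if p i ≤ p' i + min z (y - w)
      then TransProb μ U (fun c => min (p c) (p' c + min z (y - w))) p' y i j
      else 0 := by
  split_ifs with h
  · unfold TransProb
    congr 1
    ext ω
    have hmin := weakOpt_min_iff (ω := ω) (y := y) hMono
      (q := fun c => p' c + min z (y - w)) h
    simp only [Set.mem_ofPred_eq, hmin]
    constructor
    · rintro ⟨hw, hz, hi, hj⟩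
      exact ⟨⟨hi, (hCV.le_MMU_and_le_iff hCont hMono hR1 hi w z).1 ⟨hw, hz⟩⟩, hj⟩
    · rintro ⟨⟨hi, hle⟩, hj⟩
      obtain ⟨hw, hz⟩ := (hCV.le_MMU_and_le_iff hCont hMono hR1 hi w z).2 hle
      exact ⟨hw, hz, hi, hj⟩
  · convert measure_empty (μ := μ)
    refine Set.eq_empty_iff_forall_notMem.2 ?_
    rintro ω ⟨hw, hz, hi, -⟩
    have hle := (hCV.le_MMU_and_le_iff hCont hMono hR1 hi w z).1 ⟨hw, hz⟩ i
    have := (hMono ω i).le_iff_le.1 hle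
    exact h (by linarith)
end
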